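/- There exist two 3-regular simple graphs G and H on 16 vertices that are cospectral, have chromatic index 3 and 4 respectively, and such that every real orthogonal matrix Q satisfying A(G) = Qᵀ A(H) Q has at least one irrational entry; in particular, no rational orthogonal matrix Q satisfies A(G) = Qᵀ A(H) Q. -/

import Mathlib

open Matrix Polynomial

/-- The adjacency matrix over `ℝ` of a simple graph on `Fin n`. -/
noncomputable def adjMat {n : ℕ} (G : SimpleGraph (Fin n)) : Matrix (Fin n) (Fin n) ℝ :=
  letI : DecidableRel G.Adj := Classical.decRel G.Adj
  G.adjMatrix ℝ

/-- The chromatic index of a simple graph: the chromatic number of its line graph. -/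
noncomputable def chromaticIndex {V : Type*} (G : SimpleGraph V) : ℕ∞ :=
  G.lineGraph.chromaticNumber

namespace SimpleGraph

variable {V : Type*}

section EdgeClasses

variable [DecidableEq V]

/-- The index of the first class in `L` containing the unordered pair `uv`,
or `L.length` if there is none. -/
def edgeClass (L : List (List (V × V))) (u v : V) : ℕ :=
  L.findIdx fun M => (u, v) ∈ M ∨ (v, u) ∈ M

theorem edgeClass_comm (L : List (List (V × V))) (u v : V) :
    edgeClass L u v = edgeClass L v u := by
  simp only [edgeClass, or_comm]

/-- The graph whose edge set is the union of the classes in `L`. -/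
def ofEdgeClasses (L : List (List (V × V))) : SimpleGraph V where
  Adj u v := u ≠ v ∧ edgeClass L u v < L.length
  symm := ⟨fun u v h => ⟨h.1.symm, edgeClass_comm L u v ▸ h.2⟩⟩
  loopless := ⟨fun _ h => h.1 rfl⟩

instance (L : List (List (V × V))) : DecidableRel (ofEdgeClasses L).Adj :=
  fun u v => inferInstanceAs (Decidable (u ≠ v ∧ edgeClass L u v < L.length))

/-- If the classes in `L` are matchings, they form a proper edge colouring. -/
theorem lineGraph_ofEdgeClasses_colorable {L : List (List (V × V))}
    (hL : ∀ u v w, (ofEdgeClasses L).Adj u v → (ofEdgeClasses L).Adj u w →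
      edgeClass L u v = edgeClass L u w → v = w) :
    (ofEdgeClasses L).lineGraph.Colorable L.length := by
  let c : Sym2 V → ℕ := Sym2.lift ⟨edgeClass L, edgeClass_comm L⟩
  have hc : ∀ e : (ofEdgeClasses L).edgeSet, c e < L.length := by
    rintro ⟨e, he⟩
    induction e with
    | h u v => exact he.2
  refine ⟨Coloring.mk (fun e => ⟨c e, hc e⟩) ?_⟩
  rintro ⟨e, he⟩ ⟨f, hf⟩ ⟨hne, x, hxe, hxf⟩ heq
  obtain ⟨v, rfl⟩ := Sym2.mem_iff_exists.1 hxe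
  obtain ⟨w, rfl⟩ := Sym2.mem_iff_exists.1 hxf
  exact hne (by simp [hL x v w he hf (congrArg Fin.val heq)])

end EdgeClasses

section Backtracking

variable [DecidableEq V]

/-- Two pairs represent distinct edges with a common endpoint. -/
def Incident (e f : V × V) : Prop :=
  s(e.1, e.2) ≠ s(f.1, f.2) ∧ (e.1 = f.1 ∨ e.1 = f.2 ∨ e.2 = f.1 ∨ e.2 = f.2)

instance : DecidableRel (Incident (V := V)) := fun _ _ => inferInstanceAs (Decidable (_ ∧ _))

/-- Backtracking search: can the partial edge colouring `p` be extended to the edges in the list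
with `k` colours? -/
def edgeColoringExtends (k : ℕ) : List (V × V) → List ((V × V) × Fin k) → Bool
  | [], _ => true
  | e :: es, p => (List.finRange k).any fun c =>
      (p.all fun q => !decide (Incident e q.1 ∧ c = q.2)) && edgeColoringExtends k es ((e, c) :: p)

theorem edgeColoringExtends_eq_true {G : SimpleGraph V} {k : ℕ}
    (C : G.lineGraph.Coloring (Fin k)) : ∀ (es : List (V × V)) (p : List ((V × V) × Fin k)),
      (∀ e ∈ es, G.Adj e.1 e.2) →
      (∀ q ∈ p, ∃ h : G.Adj q.1.1 q.1.2, C ⟨s(q.1.1, q.1.2), h⟩ = q.2) →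
      edgeColoringExtends k es p = true
  | [], _, _, _ => rfl
  | e :: es, p, hes, hp => by
    have he : G.Adj e.1 e.2 := hes e List.mem_cons_self
    simp only [edgeColoringExtends, List.any_eq_true, Bool.and_eq_true, List.all_eq_true,
      Bool.not_eq_true', decide_eq_false_iff_not]
    refine ⟨C ⟨s(e.1, e.2), he⟩, List.mem_finRange _, ?_, ?_⟩
    · rintro q hq ⟨⟨hne, hinc⟩, hcol⟩
      obtain ⟨h, hC⟩ := hp q hq
      refine C.valid (v := ⟨s(e.1, e.2), he⟩) (w := ⟨s(q.1.1, q.1.2), h⟩) ⟨?_, ?_⟩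
        (hcol.trans hC.symm)
      · exact fun h' => hne (congrArg Subtype.val h')
      · rcases hinc with h | h | h | h
        · exact ⟨e.1, by simp, by simp [h]⟩
        · exact ⟨e.1, by simp, by simp [h]⟩
        · exact ⟨e.2, by simp, by simp [h]⟩
        · exact ⟨e.2, by simp, by simp [h]⟩
    · refine edgeColoringExtends_eq_true C es _ (fun f hf => hes f (List.mem_cons_of_mem _ hf)) ?_
      exact List.forall_mem_cons.2 ⟨⟨he, rfl⟩, hp⟩

theorem not_colorable_lineGraph_of_edgeColoringExtends {G : SimpleGraph V} {k : ℕ}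
    (es : List (V × V)) (hes : ∀ e ∈ es, G.Adj e.1 e.2)
    (h : edgeColoringExtends k es [] = false) :
    ¬ G.lineGraph.Colorable k := by
  rintro ⟨C⟩
  simpa [h] using edgeColoringExtends_eq_true C es [] hes (by simp)

end Backtracking

theorem ncard_neighborSet [Fintype V] (G : SimpleGraph V) [DecidableRel G.Adj] (v : V) :
    (G.neighborSet v).ncard = (Finset.univ.filter (G.Adj v)).card := by
  rw [← Set.ncard_coe_finset]
  congr 1
  ext w
  simp

end SimpleGraph

theorem adjMat_eq {n : ℕ} (G : SimpleGraph (Fin n)) [DecidableRel G.Adj] :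
    adjMat G = (G.adjMatrix ℤ).map (Int.castRingHom ℝ) := by
  ext i j
  simp [adjMat, SimpleGraph.adjMatrix_apply]

/-- Integer matrices intertwined by an integer matrix invertible modulo `p` have the same
characteristic polynomial over any field of characteristic zero. -/
theorem Matrix.charpoly_map_eq_of_intertwining {n K : Type*} [Fintype n] [DecidableEq n] [Field K]
    [CharZero K] {A B P : Matrix n n ℤ} (h : A * P = P * B) (p : ℕ) [Fact p.Prime]
    {R : Matrix n n (ZMod p)} (hR : P.map (Int.castRingHom (ZMod p)) * R = 1) :
    (A.map (Int.castRingHom K)).charpoly = (B.map (Int.castRingHom K)).charpoly := by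
  have hdet : P.det ≠ 0 := by
    intro h0
    have := congrArg det hR
    rw [det_mul, ← RingHom.mapMatrix_apply, ← RingHom.map_det, h0] at this
    simp at this
  have hunit : IsUnit (P.map (Int.castRingHom K)) := by
    rw [isUnit_iff_isUnit_det, ← RingHom.mapMatrix_apply, ← RingHom.map_det]
    simpa using hdet
  obtain ⟨U, hU⟩ := hunit
  have h' : A.map (Int.castRingHom K) * U = U * B.map (Int.castRingHom K) := by
    rw [hU, ← Matrix.map_mul, ← Matrix.map_mul, h]
  rw [← charpoly_units_conj U (B.map _), ← h', mul_assoc, ← coe_units_inv, Units.mul_inv,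
    mul_one]

/-- The Tait-colourable graph of the pair, given by a partition into perfect matchings. -/
def cubicMatchings : List (List (Fin 16 × Fin 16)) :=
  [[(3, 2), (4, 0), (8, 6), (9, 7), (10, 1), (11, 5), (14, 13), (15, 12)],
   [(6, 2), (8, 7), (9, 5), (10, 3), (12, 11), (13, 1), (14, 4), (15, 0)],
   [(6, 4), (9, 8), (10, 2), (11, 3), (12, 7), (13, 5), (14, 0), (15, 1)]]

/-- The Petersen graph with three vertices replaced by triangles, given by a partition
into four matchings. -/
def petersenMatchings : List (List (Fin 16 × Fin 16)) :=
  [[(2, 0), (8, 5), (10, 7), (11, 3), (12, 6), (14, 9), (15, 4)],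
   [(2, 1), (6, 3), (8, 7), (11, 4), (12, 10), (13, 9), (14, 0), (15, 5)],
   [(6, 1), (7, 5), (10, 0), (12, 9), (13, 2), (14, 4), (15, 11)],
   [(3, 1), (13, 8)]]

/-- The edges of the Petersen graph with three vertices replaced by triangles, in an order
suitable for backtracking. -/
def petersenEdges : List (Fin 16 × Fin 16) :=
  [(5, 7), (7, 8), (7, 10), (5, 8), (5, 15), (8, 13), (2, 13), (9, 13), (9, 14), (9, 12),
   (10, 12), (0, 10), (6, 12), (0, 2), (0, 14), (1, 2), (1, 6), (3, 6), (1, 3), (3, 11), (11,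
   15), (4, 11), (4, 15), (4, 14)]

/-- The graph of the pair with chromatic index `3`. -/
abbrev cubicGraph : SimpleGraph (Fin 16) := .ofEdgeClasses cubicMatchings

/-- The graph of the pair with chromatic index `4`. -/
abbrev trianglePetersen : SimpleGraph (Fin 16) := .ofEdgeClasses petersenMatchings

/-- An integer matrix intertwining the two adjacency matrices. -/
def intertwiner : Matrix (Fin 16) (Fin 16) ℤ :=
  !![0, 2, 0, 1, 0, -1, 0, -2, 0, 0, -1, 0, 1, -1, 0, 0;
     1, 1, 0, 0, 0, -1, 0, 0, -1, -1, 0, 0, 0, 0, 0, 0;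
     0, 0, 0, 0, -1, 0, 0, 0, 0, 0, 0, 0, 0, 0, 0, 0;
     0, 0, -1, 0, 0, 0, 0, 0, 0, 0, 0, -1, 0, 1, 0, 0;
     -1, 1, 0, 1, 0, -1, 1, -1, -1, 0, 0, 0, 0, 0, 0, 0;
     0, 0, -1, -1, 0, 1, -1, 0, 0, 0, 0, 0, 1, 0, 0, 0;
     0, 0, 0, 0, 0, 0, 0, 0, 0, 0, 0, 0, 0, 0, -1, 0;
     0, 0, -1, -1, 0, 1, -2, 0, 2, 0, 1, 0, -1, 0, 0, 0;
     0, -1, 0, -1, 0, 1, -1, 1, 1, -1, 0, 0, 0, 0, 0, 0;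
     0, -2, 0, -1, 0, 1, 0, 2, 0, 0, 0, -1, -1, 0, 0, 1;
     0, 0, 1, 0, 0, 0, 0, 0, 0, 0, 0, 0, 0, -1, 0, -1;
     -1, -1, 0, -1, 0, 0, 0, 0, 1, 1, 0, 0, 0, 0, 0, 0;
     0, -1, 0, 0, 0, 0, -1, 1, 0, 0, -1, 0, 0, 1, 0, 0;
     0, 0, 0, 1, 0, -1, 0, -1, 0, 0, 1, 0, 0, -1, 0, 0;
     0, 0, 0, 1, 0, -1, 2, 0, -2, 0, -1, 1, 0, 0, 0, -1;
     0, 0, 1, 0, 0, 0, 1, -1, -1, 0, 0, 0, -1, 0, 0, 0]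

/-- The inverse of `intertwiner` modulo `2`. -/
def intertwinerInv : Matrix (Fin 16) (Fin 16) (ZMod 2) :=
  !![0, 1, 0, 0, 1, 1, 0, 0, 0, 0, 0, 1, 1, 1, 0, 1;
     0, 0, 0, 1, 0, 1, 0, 1, 0, 0, 1, 0, 1, 1, 1, 0;
     0, 1, 0, 0, 0, 0, 0, 1, 0, 1, 0, 1, 0, 0, 1, 0;
     1, 0, 0, 0, 1, 0, 0, 1, 1, 1, 0, 1, 1, 0, 1, 1;
     0, 0, 1, 0, 0, 0, 0, 0, 0, 0, 0, 0, 0, 0, 0, 0;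
     1, 1, 0, 0, 1, 0, 0, 1, 1, 1, 0, 0, 1, 0, 1, 1;
     0, 1, 0, 1, 0, 1, 0, 1, 0, 0, 1, 1, 0, 0, 1, 0;
     1, 1, 0, 1, 0, 0, 0, 0, 0, 1, 1, 1, 0, 1, 0, 0;
     1, 0, 0, 1, 0, 1, 0, 0, 0, 1, 1, 0, 0, 1, 0, 1;
     0, 1, 0, 0, 0, 1, 0, 0, 1, 0, 0, 1, 1, 1, 0, 1;
     0, 1, 0, 1, 0, 0, 0, 0, 0, 0, 1, 1, 0, 0, 1, 0;
     1, 0, 0, 1, 0, 0, 0, 1, 0, 0, 0, 0, 0, 0, 0, 0;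
     0, 1, 0, 1, 0, 0, 0, 0, 0, 1, 1, 1, 0, 0, 0, 0;
     1, 1, 0, 0, 0, 0, 0, 0, 0, 1, 0, 1, 0, 0, 1, 0;
     0, 0, 0, 0, 0, 0, 1, 0, 0, 0, 0, 0, 0, 0, 0, 0;
     1, 0, 0, 0, 0, 0, 0, 1, 0, 0, 1, 0, 0, 0, 0, 0]

/-- A vector spanning the kernel of the adjacency matrix of `cubicGraph`. -/
def cubicKernel : Fin 16 → ℤ :=
  ![1, 0, 0, 0, 0, 1, 0, -1, 0, 1, 0, 0, -1, -1, -1, 1]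

theorem chromaticIndex_cubicGraph : chromaticIndex cubicGraph = 3 := by
  refine SimpleGraph.chromaticNumber_eq_iff_colorable_not_colorable (n := 2) |>.2 ⟨?_, ?_⟩
  · exact SimpleGraph.lineGraph_ofEdgeClasses_colorable (by decide +kernel)
  · exact SimpleGraph.not_colorable_lineGraph_of_edgeColoringExtends
      [(0, 4), (0, 14), (0, 15)] (by decide +kernel) (by decide +kernel)

theorem chromaticIndex_trianglePetersen : chromaticIndex trianglePetersen = 4 := by
  refine SimpleGraph.chromaticNumber_eq_iff_colorable_not_colorable (n := 3) |>.2 ⟨?_, ?_⟩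
  · exact SimpleGraph.lineGraph_ofEdgeClasses_colorable (by decide +kernel)
  · exact SimpleGraph.not_colorable_lineGraph_of_edgeColoringExtends
      petersenEdges (by decide +kernel) (by decide +kernel)

theorem charpoly_adjMat_cubicGraph :
    (adjMat cubicGraph).charpoly = (adjMat trianglePetersen).charpoly := by
  rw [adjMat_eq, adjMat_eq]
  refine Matrix.charpoly_map_eq_of_intertwining (P := intertwiner) ?_ 2 (R := intertwinerInv) ?_ <;>
    decide +kernel

theorem adjMat_cubicGraph_mulVec_kernel :
    adjMat cubicGraph *ᵥ (fun i => (cubicKernel i : ℝ)) = 0 := by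
  have h : cubicGraph.adjMatrix ℤ *ᵥ cubicKernel = 0 := funext (by decide +kernel)
  ext i
  have := congrArg (Int.castRingHom ℝ) (congrFun h i)
  rw [RingHom.map_mulVec] at this
  simpa [adjMat_eq, Function.comp_def] using this

/-- The kernel of the adjacency matrix of `trianglePetersen` is spanned by a vector of square
norm `6` whose last entry is `1`. -/
theorem dotProduct_self_of_trianglePetersen_kernel {x : Fin 16 → ℝ}
    (hx : adjMat trianglePetersen *ᵥ x = 0) :
    x ⬝ᵥ x = 6 * x 15 ^ 2 := by
  have key (i a b c : Fin 16) (h : Finset.univ.filter (trianglePetersen.Adj i) = {a, b, c} ∧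
      a ∉ ({b, c} : Finset (Fin 16)) ∧ b ≠ c) : x a + x b + x c = 0 := by
    have hi := congrFun hx i
    rw [show adjMat trianglePetersen = trianglePetersen.adjMatrix ℝ by
        ext; simp [adjMat, SimpleGraph.adjMatrix_apply],
      SimpleGraph.adjMatrix_mulVec_apply, SimpleGraph.neighborFinset_eq_filter, h.1,
      Finset.sum_insert h.2.1, Finset.sum_pair h.2.2, ← add_assoc] at hi
    exact hi
  have h0 := key 0 2 10 14 (by decide +kernel)
  have h1 := key 1 2 3 6 (by decide +kernel)
  have h2 := key 2 0 1 13 (by decide +kernel)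
  have h3 := key 3 1 6 11 (by decide +kernel)
  have h4 := key 4 11 14 15 (by decide +kernel)
  have h5 := key 5 7 8 15 (by decide +kernel)
  have h6 := key 6 1 3 12 (by decide +kernel)
  have h7 := key 7 5 8 10 (by decide +kernel)
  have h8 := key 8 5 7 13 (by decide +kernel)
  have h9 := key 9 12 13 14 (by decide +kernel)
  have h10 := key 10 0 7 12 (by decide +kernel)
  have h11 := key 11 3 4 15 (by decide +kernel)
  have h12 := key 12 6 9 10 (by decide +kernel)
  have h13 := key 13 2 8 9 (by decide +kernel)
  have h14 := key 14 0 4 9 (by decide +kernel)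
  have h15 := key 15 4 5 11 (by decide +kernel)
  have e0 : x 0 = 0 := by linarith
  have e1 : x 1 = x 15 / 2 := by linarith
  have e2 : x 2 = x 15 / 2 := by linarith
  have e3 : x 3 = -x 15 := by linarith
  have e4 : x 4 = 0 := by linarith
  have e5 : x 5 = x 15 := by linarith
  have e6 : x 6 = x 15 / 2 := by linarith
  have e7 : x 7 = -x 15 / 2 := by linarith
  have e8 : x 8 = -x 15 / 2 := by linarith
  have e9 : x 9 = 0 := by linarith
  have e10 : x 10 = -x 15 / 2 := by linarith
  have e11 : x 11 = -x 15 := by linarith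
  have e12 : x 12 = x 15 / 2 := by linarith
  have e13 : x 13 = -x 15 / 2 := by linarith
  have e14 : x 14 = 0 := by linarith
  simp [Fin.sum_univ_succ, dotProduct, e0, e1, e2, e3, e4, e5, e6, e7, e8, e9, e10, e11, e12,
    e13, e14]
  ring

theorem exists_irrational_of_orthogonal {Q : Matrix (Fin 16) (Fin 16) ℝ} (hQ : Qᵀ * Q = 1)
    (h : adjMat cubicGraph = Qᵀ * adjMat trianglePetersen * Q) : ∃ i j, Irrational (Q i j) := by
  set v : Fin 16 → ℝ := fun i => (cubicKernel i : ℝ) with hv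
  have hQ' : Q * Qᵀ = 1 := mul_eq_one_comm.1 hQ
  have hker : adjMat trianglePetersen *ᵥ (Q *ᵥ v) = 0 := by
    have h' : adjMat trianglePetersen * Q = Q * adjMat cubicGraph := by
      rw [h, ← mul_assoc, ← mul_assoc, hQ', one_mul]
    rw [mulVec_mulVec, h', ← mulVec_mulVec, adjMat_cubicGraph_mulVec_kernel, mulVec_zero]
  have hnorm : (Q *ᵥ v) ⬝ᵥ (Q *ᵥ v) = 8 := by
    rw [dotProduct_mulVec, ← mulVec_transpose, mulVec_mulVec, hQ, one_mulVec]
    have : cubicKernel ⬝ᵥ cubicKernel = 8 := by decide +kernel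
    have := congrArg (Int.castRingHom ℝ) this
    rw [RingHom.map_dotProduct] at this
    simpa [Function.comp_def] using this
  rw [dotProduct_self_of_trianglePetersen_kernel hker] at hnorm
  by_contra! hrat
  simp only [Irrational, not_not, Set.mem_range] at hrat
  choose q hq using hrat
  have hlast : (Q *ᵥ v) 15 = ((∑ j, q 15 j * cubicKernel j : ℚ) : ℝ) := by
    simp [mulVec, dotProduct, hv, hq]
  rw [hlast] at hnorm
  have hsq : IsSquare ((12 : ℕ) : ℚ) := by
    refine ⟨3 * ∑ j, q 15 j * cubicKernel j, ?_⟩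
    have : 6 * (∑ j, q 15 j * cubicKernel j) ^ 2 = (8 : ℚ) := by exact_mod_cast hnorm
    push_cast
    linarith
  rw [Rat.isSquare_natCast_iff] at hsq
  revert hsq
  decide +kernel

/-- There exist two cospectral cubic graphs on 16 vertices with chromatic indexes 3 and 4
such that every orthogonal matrix `Q` with `A(G) = Qᵀ A(H) Q` has an irrational entry;
in particular no rational orthogonal matrix realizes the similarity. -/
theorem exists_cospectral_cubic_pair_no_rational_orthogonal_similarity :
    ∃ G H : SimpleGraph (Fin 16),
      (∀ v, (G.neighborSet v).ncard = 3) ∧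
      (∀ v, (H.neighborSet v).ncard = 3) ∧
      (adjMat G).charpoly = (adjMat H).charpoly ∧
      chromaticIndex G = 3 ∧
      chromaticIndex H = 4 ∧
      (∀ Q : Matrix (Fin 16) (Fin 16) ℝ,
        Qᵀ * Q = 1 → adjMat G = Qᵀ * adjMat H * Q → ∃ i j, Irrational (Q i j)) ∧
      ¬ ∃ Q : Matrix (Fin 16) (Fin 16) ℝ,
          Qᵀ * Q = 1 ∧ (∀ i j, ∃ q : ℚ, Q i j = (q : ℝ)) ∧
          adjMat G = Qᵀ * adjMat H * Q := by
  refine ⟨cubicGraph, trianglePetersen, fun v => ?_, fun v => ?_, charpoly_adjMat_cubicGraph,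
    chromaticIndex_cubicGraph, chromaticIndex_trianglePetersen,
    fun Q => exists_irrational_of_orthogonal, ?_⟩
  · rw [SimpleGraph.ncard_neighborSet]
    revert v
    decide +kernel
  · rw [SimpleGraph.ncard_neighborSet]
    revert v
    decide +kernel
  · rintro ⟨Q, hQ, hrat, h⟩
    obtain ⟨i, j, hij⟩ := exists_irrational_of_orthogonal hQ h
    obtain ⟨q, hq⟩ := hrat i j
    exact hij ⟨q, hq.symm⟩
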